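/- For every n ≥ 1, every nonempty subset V ⊆ Fin n, every l ∈ ℝⁿ, and all valid coordinates i, j ∈ V, the partial derivative with respect to the i-th coordinate of l ↦ log(softmax(mask_{V,M}(l))_j) at l converges, as the masking constant M tends to −∞, to (1 if i = j else 0) − exp(l_i) / Σ_{k∈V} exp(l_k); that is, the invalid action masking gradient on valid logits converges to the policy gradient of the renormalized valid-action softmax distribution. -/

import Mathlib

noncomputable def softmax {n : ℕ} (l : Fin n → ℝ) (i : Fin n) : ℝ :=
  Real.exp (l i) / ∑ j, Real.exp (l j)

def maskLogits {n : ℕ} (V : Finset (Fin n)) (M : ℝ) (l : Fin n → ℝ) (i : Fin n) : ℝ :=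
  if i ∈ V then l i else M

theorem sum_exp_pos {n : ℕ} (l : Fin n → ℝ) (i : Fin n) : 0 < ∑ k, Real.exp (l k) :=
  Finset.sum_pos (fun k _ => Real.exp_pos (l k)) ⟨i, Finset.mem_univ i⟩

theorem log_softmax {n : ℕ} (l : Fin n → ℝ) (j : Fin n) :
    Real.log (softmax l j) = l j - Real.log (∑ k, Real.exp (l k)) := by
  rw [softmax, Real.log_div (Real.exp_ne_zero _) (sum_exp_pos l j).ne', Real.log_exp]

theorem hasDerivAt_update_apply {n : ℕ} (l : Fin n → ℝ) (i j : Fin n) (x : ℝ) :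
    HasDerivAt (fun t : ℝ => Function.update l i t j) (if i = j then 1 else 0) x := by
  by_cases h : i = j
  · subst h
    simpa using hasDerivAt_id' x
  · simpa [Function.update_of_ne (Ne.symm h), h] using hasDerivAt_const x (l j)

/-- The partial derivatives of the logarithm of the softmax function. -/
theorem hasDerivAt_log_softmax_update {n : ℕ} (l : Fin n → ℝ) (i j : Fin n) :
    HasDerivAt (fun t : ℝ => Real.log (softmax (Function.update l i t) j))
      ((if i = j then 1 else 0) - softmax l i) (l i) := by
  simp only [log_softmax]
  have hsum : HasDerivAt (fun t : ℝ => ∑ k, Real.exp (Function.update l i t k))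
      (Real.exp (l i)) (l i) := by
    have h := HasDerivAt.fun_sum (u := Finset.univ)
      fun k _ => (hasDerivAt_update_apply l i k (l i)).exp
    simpa using h
  have hlog := hsum.log (sum_exp_pos _ i).ne'
  rw [Function.update_eq_self] at hlog
  exact (hasDerivAt_update_apply l i j (l i)).sub hlog

theorem maskLogits_of_mem {n : ℕ} {V : Finset (Fin n)} {i : Fin n} (hi : i ∈ V) (M : ℝ)
    (l : Fin n → ℝ) : maskLogits V M l i = l i :=
  if_pos hi

theorem maskLogits_update {n : ℕ} {V : Finset (Fin n)} {i : Fin n} (hi : i ∈ V) (M : ℝ)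
    (l : Fin n → ℝ) (t : ℝ) :
    maskLogits V M (Function.update l i t) = Function.update (maskLogits V M l) i t := by
  funext k
  by_cases h : k = i
  · subst h
    simp [maskLogits, hi]
  · simp [maskLogits, h]

/-- On valid coordinates, the masked softmax converges to the renormalized softmax as the masking
constant tends to `-∞`. -/
theorem tendsto_softmax_maskLogits {n : ℕ} {V : Finset (Fin n)} {i : Fin n} (hi : i ∈ V)
    (l : Fin n → ℝ) :
    Filter.Tendsto (fun M : ℝ => softmax (maskLogits V M l) i) Filter.atBot
      (nhds (Real.exp (l i) / ∑ k ∈ V, Real.exp (l k))) := by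
  simp only [softmax, maskLogits_of_mem hi]
  have hpos : 0 < ∑ k ∈ V, Real.exp (l k) :=
    Finset.sum_pos (fun k _ => Real.exp_pos (l k)) ⟨i, hi⟩
  refine tendsto_const_nhds.div ?_ hpos.ne'
  have hterm : ∀ k ∈ Finset.univ, Filter.Tendsto (fun M : ℝ => Real.exp (maskLogits V M l k))
      Filter.atBot (nhds (if k ∈ V then Real.exp (l k) else 0)) := by
    intro k _
    by_cases hk : k ∈ V
    · simp [maskLogits, hk]
    · simpa [maskLogits, hk] using Real.tendsto_exp_atBot
  simpa [Finset.sum_ite_mem] using tendsto_finsetSum Finset.univ hterm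

theorem masked_gradient_tendsto_renormalized_gradient (n : ℕ) (hn : 1 ≤ n)
    (V : Finset (Fin n)) (hV : V.Nonempty) (l : Fin n → ℝ) (i : Fin n) (j : Fin n)
    (hi : i ∈ V) (hj : j ∈ V) :
    Filter.Tendsto
      (fun M : ℝ =>
        deriv (fun t : ℝ => Real.log (softmax (maskLogits V M (Function.update l i t)) j))
          (l i))
      Filter.atBot
      (nhds ((if i = j then (1 : ℝ) else 0) - Real.exp (l i) / ∑ k ∈ V, Real.exp (l k))) := by
  have hderiv (M : ℝ) :
      deriv (fun t : ℝ => Real.log (softmax (maskLogits V M (Function.update l i t)) j)) (l i) =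
        (if i = j then (1 : ℝ) else 0) - softmax (maskLogits V M l) i := by
    have h := hasDerivAt_log_softmax_update (maskLogits V M l) i j
    rw [maskLogits_of_mem hi] at h
    simpa only [maskLogits_update hi] using h.deriv
  simp only [hderiv]
  exact tendsto_const_nhds.sub (tendsto_softmax_maskLogits hi l)
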